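/- For every unbounded countable set T ⊂ ℝ^k whose distinct elements are at uniformly bounded distance from below, and for Haar-almost every unimodular lattice Λ in ℝ^k, the growth exponent γ_T(Λ) = limsup_{t ∈ T, ‖t‖→∞} (−log δ(g_t Λ))/‖t‖ equals zero, where g_t = diag(e^{t₁},…,e^{t_m}, e^{−t_{m+1}},…,e^{−t_k}) for t in the set A of vectors with positive coordinates satisfying t₁+⋯+t_m = t_{m+1}+⋯+t_k. -/

import Mathlib

open Matrix MeasureTheory Filter Topology

/-- Topology on `SL_k(ℝ)` induced from the space of matrices. -/
noncomputable instance SLtop (k : ℕ) :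
    TopologicalSpace (Matrix.SpecialLinearGroup (Fin k) ℝ) :=
  TopologicalSpace.induced (fun g => (g : Matrix (Fin k) (Fin k) ℝ)) inferInstance

/-- Borel σ-algebra on `SL_k(ℝ)`. -/
noncomputable instance SLmeas (k : ℕ) :
    MeasurableSpace (Matrix.SpecialLinearGroup (Fin k) ℝ) :=
  borel _

/-- The diagonal matrix `g_t = diag(e^{t₁},…,e^{t_m},e^{-t_{m+1}},…,e^{-t_k})`. -/
noncomputable def gMat (m : ℕ) {k : ℕ} (t : Fin k → ℝ) : Matrix (Fin k) (Fin k) ℝ :=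
  Matrix.diagonal fun i => if (i : ℕ) < m then Real.exp (t i) else Real.exp (-t i)

/-- `δ(hℤ^k)`: the length of the shortest nonzero vector of the lattice `hℤ^k`. -/
noncomputable def deltaLat {k : ℕ} (h : Matrix (Fin k) (Fin k) ℝ) : ℝ :=
  sInf {r : ℝ | ∃ q : Fin k → ℤ, q ≠ 0 ∧ r = ‖h.mulVec fun i => (q i : ℝ)‖}

theorem SLtop_eq (k : ℕ) : SLtop k = Matrix.SpecialLinearGroup.instTopologicalSpace := rfl

instance SLtg (k : ℕ) : IsTopologicalGroup (Matrix.SpecialLinearGroup (Fin k) ℝ) :=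
  Matrix.SpecialLinearGroup.topologicalGroup

instance SLborel (k : ℕ) : BorelSpace (Matrix.SpecialLinearGroup (Fin k) ℝ) := ⟨rfl⟩

theorem SLemb (k : ℕ) : IsClosedEmbedding
    (fun g : Matrix.SpecialLinearGroup (Fin k) ℝ => (g : Matrix (Fin k) (Fin k) ℝ)) := by
  have h : IsClosed {A : Matrix (Fin k) (Fin k) ℝ | A.det = 1} :=
    isClosed_eq (by fun_prop) continuous_const
  exact h.isClosedEmbedding_subtypeVal

instance SLsc (k : ℕ) : SecondCountableTopology (Matrix.SpecialLinearGroup (Fin k) ℝ) :=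
  haveI : SecondCountableTopology (Matrix (Fin k) (Fin k) ℝ) :=
    inferInstanceAs (SecondCountableTopology (Fin k → Fin k → ℝ))
  (SLemb k).isEmbedding.secondCountableTopology

instance SLlc (k : ℕ) : LocallyCompactSpace (Matrix.SpecialLinearGroup (Fin k) ℝ) :=
  haveI : LocallyCompactSpace (Matrix (Fin k) (Fin k) ℝ) :=
    inferInstanceAs (LocallyCompactSpace (Fin k → Fin k → ℝ))
  (SLemb k).locallyCompactSpace
instance SLt2 (k : ℕ) : T2Space (Matrix.SpecialLinearGroup (Fin k) ℝ) :=
  haveI : T2Space (Matrix (Fin k) (Fin k) ℝ) :=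
    inferInstanceAs (T2Space (Fin k → Fin k → ℝ))
  (SLemb k).isEmbedding.t2Space


theorem aux_bound {k : ℕ} (A : Matrix (Fin k) (Fin k) ℝ) (v : Fin k → ℝ) :
    ‖A *ᵥ v‖ ≤ (∑ i, ∑ j, |A i j|) * ‖v‖ := by
  rw [pi_norm_le_iff_of_nonneg (by positivity)]
  intro i
  have h1 : ‖(A *ᵥ v) i‖ ≤ ∑ j, |A i j| * ‖v‖ := by
    rw [Matrix.mulVec, dotProduct]
    refine (norm_sum_le _ _).trans (Finset.sum_le_sum fun j _ => ?_)
    rw [norm_mul, Real.norm_eq_abs (A i j)]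
    exact mul_le_mul_of_nonneg_left (norm_le_pi_norm v j) (abs_nonneg _)
  rw [← Finset.sum_mul] at h1
  refine h1.trans (mul_le_mul_of_nonneg_right ?_ (norm_nonneg _))
  exact Finset.single_le_sum (f := fun i => ∑ j, |A i j|)
    (fun i _ => Finset.sum_nonneg fun j _ => abs_nonneg _) (Finset.mem_univ i)

theorem SLcont (k : ℕ) : Continuous
    (fun g : Matrix.SpecialLinearGroup (Fin k) ℝ => (g : Matrix (Fin k) (Fin k) ℝ)) :=
  (SLemb k).continuous

theorem compact_bounds {k : ℕ} (K : Set (Matrix.SpecialLinearGroup (Fin k) ℝ)) (hK : IsCompact K) :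
    ∃ a : ℝ, 1 ≤ a ∧ ∀ g ∈ K, ∀ v : Fin k → ℝ,
      ‖(g : Matrix (Fin k) (Fin k) ℝ) *ᵥ v‖ ≤ a * ‖v‖ ∧
      ‖v‖ ≤ a * ‖(g : Matrix (Fin k) (Fin k) ℝ) *ᵥ v‖ := by
  have hc : Continuous (fun A : Matrix (Fin k) (Fin k) ℝ => ∑ i, ∑ j, |A i j|) := by
    fun_prop
  obtain ⟨a₁, h₁⟩ := hK.bddAbove_image (hc.comp (SLcont k)).continuousOn
  obtain ⟨a₂, h₂⟩ := hK.bddAbove_image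
    (hc.comp ((SLcont k).comp (continuous_inv (G := Matrix.SpecialLinearGroup (Fin k) ℝ)))).continuousOn
  refine ⟨max 1 (max a₁ a₂), le_max_left _ _, fun g hg v => ⟨?_, ?_⟩⟩
  · refine (aux_bound _ v).trans (mul_le_mul_of_nonneg_right ?_ (norm_nonneg _))
    exact (h₁ ⟨g, hg, rfl⟩).trans ((le_max_left _ _).trans (le_max_right _ _))
  · have h3 := aux_bound ((g⁻¹ : Matrix.SpecialLinearGroup (Fin k) ℝ) : Matrix (Fin k) (Fin k) ℝ)
      ((g : Matrix (Fin k) (Fin k) ℝ) *ᵥ v)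
    rw [Matrix.mulVec_mulVec, ← Matrix.SpecialLinearGroup.coe_mul, inv_mul_cancel,
      Matrix.SpecialLinearGroup.coe_one, Matrix.one_mulVec] at h3
    refine h3.trans (mul_le_mul_of_nonneg_right ?_ (norm_nonneg _))
    exact (h₂ ⟨g, hg, rfl⟩).trans ((le_max_right _ _).trans (le_max_right _ _))

/-- Scaling factor. -/
noncomputable def sFac {k : ℕ} (j : Fin k) (w : Fin k → ℝ) : ℝ := (1 + |w j|) ^ (-(1 / (k : ℝ)))

theorem sFac_pow {k : ℕ} (j : Fin k) (w : Fin k → ℝ) : sFac j w ^ k * (1 + |w j|) = 1 := by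
  have hk : (k : ℝ) ≠ 0 := by
    have := j.pos
    positivity
  have hp : 0 < 1 + |w j| := by positivity
  rw [sFac, ← Real.rpow_natCast, ← Real.rpow_mul hp.le]
  have : -(1 / (k : ℝ)) * k = -1 := by field_simp
  rw [this, Real.rpow_neg_one, inv_mul_cancel₀ hp.ne']

theorem sFac_pos {k : ℕ} (j : Fin k) (w : Fin k → ℝ) : 0 < sFac j w := by
  unfold sFac; positivity

theorem sFac_le_one {k : ℕ} (j : Fin k) (w : Fin k → ℝ) : sFac j w ≤ 1 := by
  unfold sFac
  apply Real.rpow_le_one_of_one_le_of_nonpos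
  · linarith [abs_nonneg (w j)]
  · have : (0 : ℝ) ≤ 1 / (k : ℝ) := by positivity
    linarith

theorem half_le_sFac {k : ℕ} (j : Fin k) (w : Fin k → ℝ) (hw : |w j| ≤ 1) : 1 / 2 ≤ sFac j w := by
  by_contra! h
  have h1 := sFac_pow j w
  have hk : k ≠ 0 := j.pos.ne'
  have h2 : sFac j w ^ k ≤ sFac j w := pow_le_of_le_one (sFac_pos j w).le (sFac_le_one j w) hk
  have h3 := abs_nonneg (w j)
  nlinarith [sFac_pos j w]

theorem sFac_cont {k : ℕ} (j : Fin k) : Continuous (sFac j) := by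
  unfold sFac
  refine Continuous.rpow_const (by fun_prop) fun w => Or.inl ?_
  positivity

/-- The averaging family. -/
noncomputable def hEl {k : ℕ} (j : Fin k) (w : Fin k → ℝ) : Matrix.SpecialLinearGroup (Fin k) ℝ :=
  ⟨sFac j w • (1 + Matrix.vecMulVec (fun i => |w i|) (Pi.single j 1)), by
    rw [Matrix.det_smul, Fintype.card_fin, Matrix.vecMulVec_eq Unit,
      Matrix.det_one_add_replicateCol_mul_replicateRow, single_dotProduct, one_mul]
    exact sFac_pow j w⟩

theorem hEl_mulVec {k : ℕ} (j : Fin k) (w v : Fin k → ℝ) :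
    (hEl j w : Matrix (Fin k) (Fin k) ℝ) *ᵥ v = sFac j w • (v + v j • fun i => |w i|) := by
  change (sFac j w • (1 + Matrix.vecMulVec (fun i => |w i|) (Pi.single j 1))) *ᵥ v = _
  rw [Matrix.smul_mulVec, Matrix.add_mulVec, Matrix.one_mulVec, Matrix.vecMulVec_mulVec,
    single_dotProduct, one_mul, op_smul_eq_smul]

theorem hEl_cont {k : ℕ} (j : Fin k) : Continuous (hEl j) := by
  refine continuous_induced_rng.mpr ?_
  change Continuous fun w => sFac j w • (1 + Matrix.vecMulVec (fun i => |w i|) (Pi.single j 1))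
  refine (sFac_cont j).smul (continuous_const.add ?_)
  exact Continuous.matrix_vecMulVec (by fun_prop) continuous_const

/-- The annulus attached to radius `r`. -/
def Ann {k : ℕ} (a r : ℝ) : Set (Fin k → ℝ) := {x | r ≤ a * ‖x‖ ∧ ‖x‖ ≤ 2 * a * r}

theorem Ann_meas {k : ℕ} (a r : ℝ) : MeasurableSet (Ann (k := k) a r) := by
  apply IsClosed.measurableSet
  exact (isClosed_le (continuous_const (y := r)) (continuous_const.mul continuous_norm)).inter
    (isClosed_le continuous_norm (continuous_const (y := 2 * a * r)))

/-- The compact set on which the averaging takes place. -/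
def Kp {k : ℕ} (K : Set (Matrix.SpecialLinearGroup (Fin k) ℝ)) (j : Fin k) :
    Set (Matrix.SpecialLinearGroup (Fin k) ℝ) :=
  (fun p : (Fin k → ℝ) × Matrix.SpecialLinearGroup (Fin k) ℝ => (hEl j p.1)⁻¹ * p.2) ''
    (Set.Icc 0 1 ×ˢ K)

theorem Kp_compact {k : ℕ} (K : Set (Matrix.SpecialLinearGroup (Fin k) ℝ)) (hK : IsCompact K)
    (j : Fin k) : IsCompact (Kp K j) := by
  refine (isCompact_Icc.prod hK).image ?_
  exact (((hEl_cont j).comp continuous_fst).inv).mul continuous_snd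

theorem inner_bound {k : ℕ} (j : Fin k) (K : Set (Matrix.SpecialLinearGroup (Fin k) ℝ))
    (a : ℝ) (ha : 1 ≤ a)
    (hKa : ∀ g ∈ K, ∀ v : Fin k → ℝ,
      ‖(g : Matrix (Fin k) (Fin k) ℝ) *ᵥ v‖ ≤ a * ‖v‖ ∧
      ‖v‖ ≤ a * ‖(g : Matrix (Fin k) (Fin k) ℝ) *ᵥ v‖)
    (E F : Set (Fin k → ℝ))
    (hEF : ∀ c : ℝ, 1 ≤ c → c ≤ 2 → ∀ x ∈ E, c • x ∈ F) (v : Fin k → ℝ) (hv : v ≠ 0)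
    (g : Matrix.SpecialLinearGroup (Fin k) ℝ) :
    volume {w ∈ Set.Icc (0 : Fin k → ℝ) 1 | hEl j w * g ∈ {g ∈ K |
      (g : Matrix (Fin k) (Fin k) ℝ) *ᵥ v ∈ E ∧
      |((g : Matrix (Fin k) (Fin k) ℝ) *ᵥ v) j| = ‖(g : Matrix (Fin k) (Fin k) ℝ) *ᵥ v‖}} ≤
    ENNReal.ofReal ((2 * a / ‖v‖) ^ k) * volume (F ∩ Ann a ‖v‖) := by
  set v' := (g : Matrix (Fin k) (Fin k) ℝ) *ᵥ v with hv'
  have hvn : 0 < ‖v‖ := norm_pos_iff.mpr hv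
  have key : ∀ w ∈ Set.Icc (0 : Fin k → ℝ) 1, hEl j w * g ∈ {g ∈ K |
      (g : Matrix (Fin k) (Fin k) ℝ) *ᵥ v ∈ E ∧
      |((g : Matrix (Fin k) (Fin k) ℝ) *ᵥ v) j| = ‖(g : Matrix (Fin k) (Fin k) ℝ) *ᵥ v‖} →
      ‖v‖ / (2 * a) ≤ |v' j| ∧ v' + v' j • w ∈ F ∩ Ann a ‖v‖ := by
    rintro w ⟨hw0, hw1⟩ ⟨hK, hE, hj⟩
    have hwabs : (fun i => |w i|) = w := by
      ext i; exact abs_of_nonneg (hw0 i)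
    have hb := hKa _ hK v
    have hu : ((hEl j w * g : Matrix.SpecialLinearGroup (Fin k) ℝ) : Matrix (Fin k) (Fin k) ℝ) *ᵥ v
        = sFac j w • (v' + v' j • w) := by
      rw [Matrix.SpecialLinearGroup.coe_mul, ← Matrix.mulVec_mulVec, hEl_mulVec, hwabs]
    rw [hu] at hE hj hb
    have hs0 := sFac_pos j w
    have hs1 := sFac_le_one j w
    have hwj : |w j| ≤ 1 := by rw [abs_of_nonneg (hw0 j)]; exact hw1 j
    have hs2 := half_le_sFac j w hwj
    set s := sFac j w
    set x := v' + v' j • w with hx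
    have hxj : x j = v' j * (1 + w j) := by simp [hx]; ring
    rw [norm_smul, Real.norm_of_nonneg hs0.le] at hb hj
    have hxn := norm_nonneg x
    refine ⟨?_, ?_, ?_, ?_⟩
    · rw [div_le_iff₀ (by positivity)]
      have h5 : s * ‖x‖ ≤ 2 * |v' j| := by
        rw [← hj, Pi.smul_apply, smul_eq_mul, abs_mul, abs_of_pos hs0, hxj, abs_mul]
        have h0 := hw0 j
        have h1 := hw1 j
        simp only [Pi.zero_apply, Pi.one_apply] at h0 h1
        rw [abs_of_nonneg (by linarith : 0 ≤ 1 + w j)]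
        have h6 : s * (|v' j| * (1 + w j)) ≤ 1 * (|v' j| * (1 + w j)) :=
          mul_le_mul_of_nonneg_right hs1 (mul_nonneg (abs_nonneg _) (by linarith))
        nlinarith [abs_nonneg (v' j)]
      nlinarith [hb.2]
    · have := hEF s⁻¹ ((one_le_inv₀ hs0).mpr hs1) (by
        rw [inv_le_comm₀ hs0 (by norm_num)]; linarith) _ hE
      rwa [smul_smul, inv_mul_cancel₀ hs0.ne', one_smul] at this
    · refine hb.2.trans (mul_le_mul_of_nonneg_left ?_ (by linarith))
      nlinarith
    · nlinarith [hb.1]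
  set S := {w ∈ Set.Icc (0 : Fin k → ℝ) 1 | hEl j w * g ∈ {g ∈ K |
      (g : Matrix (Fin k) (Fin k) ℝ) *ᵥ v ∈ E ∧
      |((g : Matrix (Fin k) (Fin k) ℝ) *ᵥ v) j| = ‖(g : Matrix (Fin k) (Fin k) ℝ) *ᵥ v‖}} with hS
  rcases S.eq_empty_or_nonempty with h0 | ⟨w0, hw0⟩
  · rw [h0]; simp
  have hlow := (key w0 hw0.1 hw0.2).1
  have hpos : 0 < |v' j| := lt_of_lt_of_le (by positivity) hlow
  have hne : v' j ≠ 0 := abs_pos.mp hpos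
  have hsub : S ⊆ (fun w => v' j • w) ⁻¹' ((fun y => v' + y) ⁻¹' (F ∩ Ann a ‖v‖)) := by
    intro w hw
    exact (key w hw.1 hw.2).2
  refine (measure_mono hsub).trans ?_
  rw [Measure.addHaar_preimage_smul volume hne, measure_preimage_add, Module.finrank_fin_fun]
  gcongr
  rw [abs_inv, abs_pow, ← inv_pow]
  refine pow_le_pow_left₀ (by positivity) ?_ k
  rw [inv_le_comm₀ hpos (by positivity), inv_div]
  exact hlow

theorem single_bound {k : ℕ} (μ : Measure (Matrix.SpecialLinearGroup (Fin k) ℝ)) [μ.IsHaarMeasure]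
    (j : Fin k) (K : Set (Matrix.SpecialLinearGroup (Fin k) ℝ)) (hK : IsCompact K)
    (a : ℝ) (ha : 1 ≤ a)
    (hKa : ∀ g ∈ K, ∀ v : Fin k → ℝ,
      ‖(g : Matrix (Fin k) (Fin k) ℝ) *ᵥ v‖ ≤ a * ‖v‖ ∧
      ‖v‖ ≤ a * ‖(g : Matrix (Fin k) (Fin k) ℝ) *ᵥ v‖)
    (E F : Set (Fin k → ℝ)) (hE : MeasurableSet E)
    (hEF : ∀ c : ℝ, 1 ≤ c → c ≤ 2 → ∀ x ∈ E, c • x ∈ F) (v : Fin k → ℝ) (hv : v ≠ 0) :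
    μ {g ∈ K | (g : Matrix (Fin k) (Fin k) ℝ) *ᵥ v ∈ E ∧
      |((g : Matrix (Fin k) (Fin k) ℝ) *ᵥ v) j| = ‖(g : Matrix (Fin k) (Fin k) ℝ) *ᵥ v‖} ≤
    μ (Kp K j) * (ENNReal.ofReal ((2 * a / ‖v‖) ^ k) * volume (F ∩ Ann a ‖v‖)) := by
  set S := {g ∈ K | (g : Matrix (Fin k) (Fin k) ℝ) *ᵥ v ∈ E ∧
      |((g : Matrix (Fin k) (Fin k) ℝ) *ᵥ v) j| = ‖(g : Matrix (Fin k) (Fin k) ℝ) *ᵥ v‖} with hS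
  have hcv : Continuous fun g : Matrix.SpecialLinearGroup (Fin k) ℝ =>
      (g : Matrix (Fin k) (Fin k) ℝ) *ᵥ v :=
    Continuous.matrix_mulVec (SLcont k) continuous_const
  have hSm : MeasurableSet S := by
    refine hK.isClosed.measurableSet.inter ((hcv.measurable hE).inter ?_)
    refine IsClosed.measurableSet (isClosed_eq ?_ hcv.norm)
    exact ((continuous_apply j).comp hcv).abs
  have hWm : MeasurableSet (Set.Icc (0 : Fin k → ℝ) 1) := isClosed_Icc.measurableSet
  have hcm : Continuous fun p : (Fin k → ℝ) × Matrix.SpecialLinearGroup (Fin k) ℝ =>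
      hEl j p.1 * p.2 := ((hEl_cont j).comp continuous_fst).mul continuous_snd
  have e1 : μ S = ∫⁻ w in Set.Icc (0 : Fin k → ℝ) 1, ∫⁻ g, S.indicator 1 (hEl j w * g) ∂μ := by
    have : ∀ w, ∫⁻ g, S.indicator 1 (hEl j w * g) ∂μ = μ S := by
      intro w
      rw [lintegral_mul_left_eq_self (μ := μ) (S.indicator 1) (hEl j w), lintegral_indicator_one hSm]
    simp_rw [this]
    rw [lintegral_const, Measure.restrict_apply_univ, Real.volume_Icc_pi]
    simp
  rw [e1, lintegral_lintegral_swap]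
  swap
  · refine Measurable.aemeasurable ?_
    exact (measurable_one.indicator hSm).comp hcm.measurable
  have hKm : MeasurableSet (Kp K j) := (Kp_compact K hK j).isClosed.measurableSet
  set B := ENNReal.ofReal ((2 * a / ‖v‖) ^ k) * volume (F ∩ Ann a ‖v‖)
  calc _ ≤ ∫⁻ g, (Kp K j).indicator (fun _ => B) g ∂μ := by
        refine lintegral_mono fun g => ?_
        have hm : MeasurableSet {w | hEl j w * g ∈ S} :=
          (hcm.measurable.comp (measurable_id.prodMk measurable_const)) hSm
        have e2 : ∫⁻ w in Set.Icc (0 : Fin k → ℝ) 1, S.indicator 1 (hEl j w * g) =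
            volume {w ∈ Set.Icc (0 : Fin k → ℝ) 1 | hEl j w * g ∈ S} := by
          have : (fun w => S.indicator (1 : Matrix.SpecialLinearGroup (Fin k) ℝ → ENNReal) (hEl j w * g)) =
            Set.indicator {w | hEl j w * g ∈ S} 1 := rfl
          rw [this, lintegral_indicator_one hm, Measure.restrict_apply hm, Set.inter_comm]
          rfl
        rw [e2]
        by_cases hg : g ∈ Kp K j
        · rw [Set.indicator_of_mem hg]
          exact inner_bound j K a ha hKa E F hEF v hv g
        · have : {w ∈ Set.Icc (0 : Fin k → ℝ) 1 | hEl j w * g ∈ S} = ∅ := by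
            ext w
            simp only [Set.mem_ofPred_eq, Set.mem_empty_iff_false, iff_false]
            rintro ⟨hw, hgS⟩
            exact hg ⟨(w, hEl j w * g), ⟨hw, hgS.1⟩, by simp⟩
          rw [this]; simp
    _ = μ (Kp K j) * B := by
        rw [lintegral_indicator_const hKm, mul_comm]

/-- Cast of an integer vector. -/
def vR {k : ℕ} (q : Fin k → ℤ) : Fin k → ℝ := fun i => (q i : ℝ)

theorem vR_ne {k : ℕ} (q : Fin k → ℤ) (hq : q ≠ 0) : vR q ≠ 0 := by
  contrapose! hq
  ext i
  have := congrFun hq i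
  simpa [vR] using this

theorem one_le_vR {k : ℕ} (q : Fin k → ℤ) (hq : q ≠ 0) : 1 ≤ ‖vR q‖ := by
  obtain ⟨i, hi⟩ := Function.ne_iff.mp hq
  refine le_trans ?_ (norm_le_pi_norm (vR q) i)
  rw [vR, Real.norm_eq_abs]
  exact_mod_cast Int.one_le_abs hi

theorem count_bound {k : ℕ} (hk : k ≠ 0) (a : ℝ) (ha : 1 ≤ a) (x : Fin k → ℝ) :
    ∑' q : Fin k → ℤ, ENNReal.ofReal ((2 * a / ‖vR q‖) ^ k) * (Ann a ‖vR q‖).indicator 1 x ≤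
      ENNReal.ofReal ((12 * a ^ 3) ^ k) := by
  classical
  set N : ℤ := ⌊a * ‖x‖⌋ with hN
  set s : Finset (Fin k → ℤ) := Fintype.piFinset fun _ => Finset.Icc (-N) N with hs
  have hN0 : 0 ≤ N := Int.floor_nonneg.mpr (by positivity)
  have hout : ∀ q ∉ s, ENNReal.ofReal ((2 * a / ‖vR q‖) ^ k) *
      (Ann a ‖vR q‖).indicator (1 : (Fin k → ℝ) → ENNReal) x = 0 := by
    intro q hq
    rw [Set.indicator_of_notMem, mul_zero]
    intro hx
    apply hq
    rw [hs, Fintype.mem_piFinset]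
    intro i
    have h1 : |(q i : ℝ)| ≤ a * ‖x‖ := (norm_le_pi_norm (vR q) i).trans hx.1
    have h2 : |q i| ≤ N := by
      rw [hN, Int.le_floor]
      push_cast
      exact h1
    rw [Finset.mem_Icc]
    exact abs_le.mp h2
  rw [tsum_eq_sum hout]
  rcases lt_or_ge (a * ‖x‖) 1 with hx1 | hx1
  · refine le_of_eq_of_le (Finset.sum_eq_zero fun q _ => ?_) zero_le
    by_cases hq : q = 0
    · subst hq
      have : ‖vR (0 : Fin k → ℤ)‖ = 0 := by
        rw [norm_eq_zero]; ext i; simp [vR]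
      rw [this]; simp [hk]
    · rw [Set.indicator_of_notMem, mul_zero]
      intro hx
      linarith [one_le_vR q hq, hx.1]
  have hxpos : 0 < ‖x‖ := by
    by_contra! h
    nlinarith [norm_nonneg x]
  have hterm : ∀ q ∈ s, ENNReal.ofReal ((2 * a / ‖vR q‖) ^ k) *
      (Ann a ‖vR q‖).indicator (1 : (Fin k → ℝ) → ENNReal) x ≤
        ENNReal.ofReal ((4 * a ^ 2 / ‖x‖) ^ k) := by
    intro q _
    by_cases hx : x ∈ Ann a ‖vR q‖
    · rw [Set.indicator_of_mem hx, Pi.one_apply, mul_one]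
      refine ENNReal.ofReal_le_ofReal (pow_le_pow_left₀ (by positivity) ?_ k)
      have h2 := hx.2
      have h3 : 0 < ‖vR q‖ := by
        by_contra! h
        nlinarith
      rw [div_le_div_iff₀ h3 hxpos]
      nlinarith
    · rw [Set.indicator_of_notMem hx, mul_zero]; exact zero_le
  refine (Finset.sum_le_card_nsmul _ _ _ hterm).trans ?_
  have hcard : (s.card : ℝ) ≤ (3 * (a * ‖x‖)) ^ k := by
    rw [hs, Fintype.card_piFinset, Finset.prod_const, Int.card_Icc, Finset.card_univ,
      Fintype.card_fin]
    push_cast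
    refine pow_le_pow_left₀ (by positivity) ?_ k
    have h1 : ((N + 1 - -N).toNat : ℝ) = 2 * N + 1 := by
      have : ((N + 1 - -N).toNat : ℤ) = 2 * N + 1 := by omega
      exact_mod_cast this
    rw [h1]
    have := Int.floor_le (a * ‖x‖)
    rw [← hN] at this
    linarith
  rw [nsmul_eq_mul, ← ENNReal.ofReal_natCast, ← ENNReal.ofReal_mul (by positivity)]
  refine ENNReal.ofReal_le_ofReal ((mul_le_mul_of_nonneg_right hcard (by positivity)).trans ?_)
  rw [← mul_pow]
  refine le_of_eq ?_
  congr 1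
  field_simp
  norm_num

theorem sum_bound {k : ℕ} (hk : k ≠ 0) (a : ℝ) (ha : 1 ≤ a) (F : Set (Fin k → ℝ)) :
    ∑' q : Fin k → ℤ, ENNReal.ofReal ((2 * a / ‖vR q‖) ^ k) * volume (F ∩ Ann a ‖vR q‖) ≤
      ENNReal.ofReal ((12 * a ^ 3) ^ k) * volume F := by
  have h : ∀ q : Fin k → ℤ, ENNReal.ofReal ((2 * a / ‖vR q‖) ^ k) * volume (F ∩ Ann a ‖vR q‖) =
      ∫⁻ x in F, ENNReal.ofReal ((2 * a / ‖vR q‖) ^ k) * (Ann a ‖vR q‖).indicator 1 x := by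
    intro q
    rw [lintegral_const_mul _ (measurable_one.indicator (Ann_meas _ _)),
      lintegral_indicator_one (Ann_meas _ _), Measure.restrict_apply (Ann_meas _ _), Set.inter_comm]
  simp_rw [h]
  rw [← lintegral_tsum fun q =>
    ((measurable_one.indicator (Ann_meas _ _)).const_mul _).aemeasurable]
  refine (lintegral_mono fun x => count_bound hk a ha x).trans ?_
  rw [lintegral_const, Measure.restrict_apply_univ]

theorem main_bound {k : ℕ} (hk : k ≠ 0) (μ : Measure (Matrix.SpecialLinearGroup (Fin k) ℝ))
    [μ.IsHaarMeasure] (K : Set (Matrix.SpecialLinearGroup (Fin k) ℝ)) (hK : IsCompact K) :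
    ∃ C : ENNReal, C ≠ ⊤ ∧ ∀ E F : Set (Fin k → ℝ), MeasurableSet E →
      (∀ c : ℝ, 1 ≤ c → c ≤ 2 → ∀ x ∈ E, c • x ∈ F) →
      μ {g ∈ K | ∃ q : Fin k → ℤ, q ≠ 0 ∧ (g : Matrix (Fin k) (Fin k) ℝ) *ᵥ vR q ∈ E} ≤
        C * volume F := by
  obtain ⟨a, ha, hKa⟩ := compact_bounds K hK
  refine ⟨(∑ j, μ (Kp K j)) * ENNReal.ofReal ((12 * a ^ 3) ^ k),
    ENNReal.mul_ne_top ?_ ENNReal.ofReal_ne_top, fun E F hE hEF => ?_⟩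
  · exact (ENNReal.sum_lt_top.mpr fun j _ => (Kp_compact K hK j).measure_lt_top).ne
  have : Nonempty (Fin k) := ⟨⟨0, Nat.pos_of_ne_zero hk⟩⟩
  have hsub : {g ∈ K | ∃ q : Fin k → ℤ, q ≠ 0 ∧ (g : Matrix (Fin k) (Fin k) ℝ) *ᵥ vR q ∈ E} ⊆
      ⋃ q : Fin k → ℤ, ⋃ j : Fin k, {g | q ≠ 0 ∧ g ∈ {g ∈ K |
        (g : Matrix (Fin k) (Fin k) ℝ) *ᵥ vR q ∈ E ∧
      |((g : Matrix (Fin k) (Fin k) ℝ) *ᵥ vR q) j| = ‖(g : Matrix (Fin k) (Fin k) ℝ) *ᵥ vR q‖}} := by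
    rintro g ⟨hgK, q, hq, hqE⟩
    obtain ⟨j, hj⟩ := Finite.exists_max
      fun j => |((g : Matrix (Fin k) (Fin k) ℝ) *ᵥ vR q) j|
    refine Set.mem_iUnion.mpr ⟨q, Set.mem_iUnion.mpr ⟨j, hq, hgK, hqE, le_antisymm ?_ ?_⟩⟩
    · exact norm_le_pi_norm ((g : Matrix (Fin k) (Fin k) ℝ) *ᵥ vR q) j
    · exact (pi_norm_le_iff_of_nonneg (abs_nonneg _)).mpr hj
  refine (measure_mono hsub).trans ((measure_iUnion_le _).trans ?_)
  calc _ ≤ ∑' q : Fin k → ℤ, (∑ j, μ (Kp K j)) *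
        (ENNReal.ofReal ((2 * a / ‖vR q‖) ^ k) * volume (F ∩ Ann a ‖vR q‖)) := by
        refine ENNReal.tsum_le_tsum fun q => (measure_iUnion_le _).trans ?_
        rw [tsum_fintype, Finset.sum_mul]
        refine Finset.sum_le_sum fun j _ => ?_
        by_cases hq : q = 0
        · simp [hq]
        · refine (measure_mono ?_).trans
            (single_bound μ j K hK a ha hKa E F hE hEF (vR q) (vR_ne q hq))
          intro g hg
          exact hg.2
    _ ≤ _ := by
        rw [ENNReal.tsum_mul_left, mul_assoc]
        gcongr
        exact sum_bound hk a ha F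

theorem sep_sum {k : ℕ} (T : Set (Fin k → ℝ)) (hTc : T.Countable)
    (hTsep : ∃ ε > (0 : ℝ), ∀ t₁ ∈ T, ∀ t₂ ∈ T, t₁ ≠ t₂ → ε ≤ dist t₁ t₂) (c : ℝ) (hc : 0 < c) :
    ∑' t : T, ENNReal.ofReal (Real.exp (-(c * ‖(t : Fin k → ℝ)‖))) ≠ ⊤ := by
  obtain ⟨ε, hε, hsep⟩ := hTsep
  have : Countable T := hTc.to_subtype
  set r : ℕ := k + 1 with hr
  set f : (Fin k → ℝ) → ENNReal := fun x => ENNReal.ofReal ((1 + ‖x‖) ^ (-(r : ℝ))) with hf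
  have hfin : ∫⁻ x, f x < ⊤ := finite_integral_one_add_norm (by simp [hr])
  set D : ℝ := (Nat.factorial r) / c ^ r * Real.exp (c * (1 + ε)) with hD
  have hDpos : 0 < D := by positivity
  set b : ENNReal := volume (Metric.ball (0 : Fin k → ℝ) (ε / 2)) with hb
  have hb0 : b ≠ 0 := (Metric.measure_ball_pos _ _ (by positivity)).ne'
  have hbt : b ≠ ⊤ := measure_ball_lt_top.ne
  have hpt : ∀ t x : Fin k → ℝ, x ∈ Metric.ball t (ε / 2) →
      ENNReal.ofReal (Real.exp (-(c * ‖t‖))) ≤ ENNReal.ofReal D * f x := by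
    intro t x hx
    rw [hf, ← ENNReal.ofReal_mul hDpos.le]
    refine ENNReal.ofReal_le_ofReal ?_
    have hxt : ‖x‖ ≤ ‖t‖ + ε := by
      have h1 : ‖x - t‖ < ε / 2 := by rwa [← dist_eq_norm]
      have h2 : ‖x‖ ≤ ‖t‖ + ‖x - t‖ := by
        simpa using norm_add_le t (x - t)
      linarith
    have hp : 0 < 1 + ‖x‖ := by positivity
    rw [Real.rpow_neg hp.le, Real.rpow_natCast, ← div_eq_mul_inv, le_div_iff₀ (by positivity)]
    have h3 := Real.pow_div_factorial_le_exp (c * (1 + ‖x‖)) (by positivity) r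
    rw [mul_pow, div_le_iff₀ (by positivity)] at h3
    have h4 : Real.exp (c * (1 + ‖x‖)) ≤ Real.exp (c * (1 + ε)) * Real.exp (c * ‖t‖) := by
      rw [← Real.exp_add]
      apply Real.exp_le_exp.mpr
      nlinarith
    have h5 : (1 + ‖x‖) ^ r ≤ D * Real.exp (c * ‖t‖) := by
      rw [hD, div_mul_eq_mul_div, div_mul_eq_mul_div, le_div_iff₀ (by positivity)]
      have : (0 : ℝ) ≤ (Nat.factorial r : ℝ) := by positivity
      nlinarith
    calc Real.exp (-(c * ‖t‖)) * (1 + ‖x‖) ^ r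
        ≤ Real.exp (-(c * ‖t‖)) * (D * Real.exp (c * ‖t‖)) := by gcongr
      _ = D := by
        rw [Real.exp_neg]; field_simp
  have h1 : ∀ t : T, ENNReal.ofReal (Real.exp (-(c * ‖(t : Fin k → ℝ)‖))) * b ≤
      ENNReal.ofReal D * ∫⁻ x in Metric.ball (t : Fin k → ℝ) (ε / 2), f x := by
    intro t
    rw [← lintegral_const_mul' _ _ ENNReal.ofReal_ne_top, hb,
      ← Measure.addHaar_ball_center volume (t : Fin k → ℝ), ← setLIntegral_const]
    exact setLIntegral_mono' Metric.isOpen_ball.measurableSet fun x hx => hpt t x hx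
  have hdisj : Pairwise (Function.onFun Disjoint
      fun t : T => Metric.ball (t : Fin k → ℝ) (ε / 2)) := by
    intro t s hts
    apply Metric.ball_disjoint_ball
    have := hsep t t.2 s s.2 (fun h => hts (Subtype.ext h))
    linarith
  have h2 : (∑' t : T, ENNReal.ofReal (Real.exp (-(c * ‖(t : Fin k → ℝ)‖)))) * b ≤
      ENNReal.ofReal D * ∫⁻ x, f x := by
    rw [← ENNReal.tsum_mul_right]
    refine (ENNReal.tsum_le_tsum h1).trans ?_
    rw [ENNReal.tsum_mul_left, ← lintegral_iUnion (fun t => Metric.isOpen_ball.measurableSet) hdisj]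
    gcongr
    exact Measure.restrict_le_self
  intro htop
  rw [htop, ENNReal.top_mul hb0, top_le_iff] at h2
  exact ENNReal.mul_ne_top ENNReal.ofReal_ne_top hfin.ne h2

theorem vol_pre {k : ℕ} (A : Matrix (Fin k) (Fin k) ℝ) (hA : A.det = 1) (s : Set (Fin k → ℝ)) :
    volume ((fun x => A *ᵥ x) ⁻¹' s) = volume s := by
  have h := Measure.addHaar_preimage_linearMap (volume : Measure (Fin k → ℝ))
    (f := Matrix.toLin' A) (by rw [LinearMap.det_toLin', hA]; exact one_ne_zero) s
  rw [LinearMap.det_toLin', hA] at h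
  rw [inv_one, abs_one, ENNReal.ofReal_one, one_mul] at h
  exact h

theorem delta_le_one {k : ℕ} (hk : k ≠ 0) (A : Matrix (Fin k) (Fin k) ℝ) (hA : A.det = 1) :
    deltaLat A ≤ 1 := by
  have : Nonempty (Fin k) := ⟨⟨0, Nat.pos_of_ne_zero hk⟩⟩
  have hcont : Continuous fun x : Fin k → ℝ => A *ᵥ x :=
    Continuous.matrix_mulVec continuous_const continuous_id
  set s := (fun x => A *ᵥ x) ⁻¹' Metric.closedBall (0 : Fin k → ℝ) 1 with hs
  set b := Pi.basisFun ℝ (Fin k) with hb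
  have hinv : ∀ x, A⁻¹ *ᵥ (A *ᵥ x) = x := fun x => by
    rw [Matrix.mulVec_mulVec, Matrix.nonsing_inv_mul _ (by rw [hA]; exact isUnit_one),
      Matrix.one_mulVec]
  have hcpt : IsCompact s := by
    have h1 : IsCompact ((fun x => A⁻¹ *ᵥ x) '' Metric.closedBall (0 : Fin k → ℝ) 1) :=
      (isCompact_closedBall _ _).image (Continuous.matrix_mulVec continuous_const continuous_id)
    refine h1.of_isClosed_subset (Metric.isClosed_closedBall.preimage hcont) fun x hx => ?_
    exact ⟨A *ᵥ x, hx, hinv x⟩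
  have hconv : Convex ℝ s := by
    have : s = (Matrix.toLin' A) ⁻¹' Metric.closedBall (0 : Fin k → ℝ) 1 := by
      ext x; simp [hs]
    rw [this]
    exact (convex_closedBall _ _).linear_preimage _
  have hsymm : ∀ x ∈ s, -x ∈ s := by
    intro x hx
    simp only [hs, Set.mem_preimage, mem_closedBall_zero_iff, Matrix.mulVec_neg, norm_neg] at hx ⊢
    exact hx
  have hcount : Countable (Submodule.span ℤ (Set.range b)).toAddSubgroup :=
    inferInstanceAs (Countable (Submodule.span ℤ (Set.range b)))
  have hdisc : DiscreteTopology (Submodule.span ℤ (Set.range b)).toAddSubgroup :=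
    inferInstanceAs (DiscreteTopology (Submodule.span ℤ (Set.range b)))
  obtain ⟨x, hx0, hxs⟩ := exists_ne_zero_mem_lattice_of_measure_mul_two_pow_le_measure
    (ZSpan.isAddFundamentalDomain' b volume) hsymm hconv hcpt (by
      rw [hs, vol_pre A hA, hb, ZSpan.fundamentalDomain_pi_basisFun, volume_pi_pi,
        Real.volume_pi_closedBall _ zero_le_one]
      simp)
  have hxm := x.2
  have hxr : ∀ i, ∃ n : ℤ, (n : ℝ) = (x : Fin k → ℝ) i := by
    intro i
    have := (b.mem_span_iff_repr_mem ℤ (x : Fin k → ℝ)).mp hxm i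
    simpa [hb] using this
  choose q hq using hxr
  have hqx : (fun i => (q i : ℝ)) = (x : Fin k → ℝ) := funext hq
  have hq0 : q ≠ 0 := by
    rintro rfl
    apply hx0
    apply Subtype.ext
    rw [← hqx]; ext i; simp
  have hmem : ‖A.mulVec fun i => (q i : ℝ)‖ ∈
      {r : ℝ | ∃ q : Fin k → ℤ, q ≠ 0 ∧ r = ‖A.mulVec fun i => (q i : ℝ)‖} := ⟨q, hq0, rfl⟩
  refine (csInf_le ⟨0, ?_⟩ hmem).trans ?_
  · rintro r ⟨q, -, rfl⟩; exact norm_nonneg _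
  · rw [hqx]
    simpa [hs] using hxs

theorem gMat_det {m k : ℕ} (t : Fin k → ℝ)
    (ht : ∑ i ∈ Finset.univ.filter (fun i : Fin k => (i : ℕ) < m), t i =
        ∑ i ∈ Finset.univ.filter (fun i : Fin k => ¬ (i : ℕ) < m), t i) :
    (gMat m t).det = 1 := by
  rw [gMat, Matrix.det_diagonal]
  have : ∀ i : Fin k, (if (i : ℕ) < m then Real.exp (t i) else Real.exp (-t i)) =
      Real.exp (if (i : ℕ) < m then t i else - t i) := fun i => by split_ifs <;> rfl
  simp_rw [this]
  rw [← Real.exp_sum, Finset.sum_ite, ht, Finset.sum_neg_distrib, add_neg_cancel, Real.exp_zero]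

theorem delta_lt {k : ℕ} (hk : k ≠ 0) (A : Matrix (Fin k) (Fin k) ℝ) (r : ℝ) (h : deltaLat A < r) :
    ∃ q : Fin k → ℤ, q ≠ 0 ∧ ‖A *ᵥ vR q‖ < r := by
  have : Nonempty (Fin k) := ⟨⟨0, Nat.pos_of_ne_zero hk⟩⟩
  have hne : {r : ℝ | ∃ q : Fin k → ℤ, q ≠ 0 ∧ r = ‖A.mulVec fun i => (q i : ℝ)‖}.Nonempty :=
    ⟨_, 1, one_ne_zero, rfl⟩
  obtain ⟨_, ⟨q, hq, rfl⟩, hlt⟩ := (csInf_lt_iff ⟨0, by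
    rintro r ⟨q, -, rfl⟩; exact norm_nonneg _⟩ hne).mp h
  exact ⟨q, hq, hlt⟩

theorem ae_finite {m k : ℕ} (hk : k ≠ 0)
    (T : Set (Fin k → ℝ)) (hTc : T.Countable)
    (hTA : ∀ t ∈ T, (∀ i, 0 < t i) ∧
      ∑ i ∈ Finset.univ.filter (fun i : Fin k => (i : ℕ) < m), t i =
        ∑ i ∈ Finset.univ.filter (fun i : Fin k => ¬ (i : ℕ) < m), t i)
    (hTsep : ∃ ε > (0 : ℝ), ∀ t₁ ∈ T, ∀ t₂ ∈ T, t₁ ≠ t₂ → ε ≤ dist t₁ t₂)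
    (μ : Measure (Matrix.SpecialLinearGroup (Fin k) ℝ)) [μ.IsHaarMeasure]
    (K : Set (Matrix.SpecialLinearGroup (Fin k) ℝ)) (hK : IsCompact K) (η : ℝ) (hη : 0 < η) :
    ∀ᵐ g : Matrix.SpecialLinearGroup (Fin k) ℝ ∂μ, g ∈ K →
      {t : T | deltaLat (gMat m (t : Fin k → ℝ) * (g : Matrix (Fin k) (Fin k) ℝ)) <
        Real.exp (-(η * ‖(t : Fin k → ℝ)‖))}.Finite := by
  have : Countable T := hTc.to_subtype
  obtain ⟨C, hC, hb⟩ := main_bound hk μ K hK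
  set s : T → Set (Matrix.SpecialLinearGroup (Fin k) ℝ) := fun t =>
    {g ∈ K | deltaLat (gMat m (t : Fin k → ℝ) * (g : Matrix (Fin k) (Fin k) ℝ)) <
        Real.exp (-(η * ‖(t : Fin k → ℝ)‖))} with hs
  have hkey : ∀ t : T, μ (s t) ≤ C * ENNReal.ofReal (4 ^ k) *
      ENNReal.ofReal (Real.exp (-((k * η) * ‖(t : Fin k → ℝ)‖))) := by
    intro t
    set e := Real.exp (-(η * ‖(t : Fin k → ℝ)‖)) with he
    have hcont : Continuous fun x : Fin k → ℝ => gMat m (t : Fin k → ℝ) *ᵥ x :=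
      Continuous.matrix_mulVec continuous_const continuous_id
    have h1 := hb ((fun x => gMat m (t : Fin k → ℝ) *ᵥ x) ⁻¹' Metric.ball 0 e)
      ((fun x => gMat m (t : Fin k → ℝ) *ᵥ x) ⁻¹' Metric.ball 0 (2 * e))
      (Metric.isOpen_ball.preimage hcont).measurableSet (by
        intro c hc1 hc2 x hx
        simp only [Set.mem_preimage, mem_ball_zero_iff, Matrix.mulVec_smul, norm_smul] at hx ⊢
        rw [Real.norm_of_nonneg (by linarith)]
        nlinarith [norm_nonneg (gMat m (t : Fin k → ℝ) *ᵥ x)])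
    rw [vol_pre _ (gMat_det _ (hTA t t.2).2), Real.volume_pi_ball _ (by positivity)] at h1
    have h2 : ENNReal.ofReal ((2 * (2 * e)) ^ Fintype.card (Fin k)) =
        ENNReal.ofReal (4 ^ k) *
      ENNReal.ofReal (Real.exp (-((k * η) * ‖(t : Fin k → ℝ)‖))) := by
      rw [← ENNReal.ofReal_mul (by positivity), Fintype.card_fin, ← mul_assoc, mul_pow, he,
        ← Real.exp_nat_mul]
      norm_num
      ring_nf
    rw [h2, ← mul_assoc] at h1
    refine le_trans (measure_mono ?_) h1
    rintro g ⟨hgK, hg⟩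
    obtain ⟨q, hq, hlt⟩ := delta_lt hk _ _ hg
    refine ⟨hgK, q, hq, ?_⟩
    simp only [Set.mem_preimage, mem_ball_zero_iff]
    rwa [Matrix.mulVec_mulVec]
  have hsum : ∑' t, μ (s t) ≠ ⊤ := by
    refine ne_top_of_le_ne_top ?_ (ENNReal.tsum_le_tsum hkey)
    rw [ENNReal.tsum_mul_left]
    refine ENNReal.mul_ne_top (ENNReal.mul_ne_top hC ENNReal.ofReal_ne_top) ?_
    exact sep_sum T hTc hTsep (k * η) (by positivity)
  filter_upwards [ae_finite_setOfPred_mem hsum] with g hg hgK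
  refine hg.subset fun t ht => ?_
  exact ⟨hgK, ht⟩

/-- For any unbounded countable subset `T` of
`A = {t : tᵢ > 0, t₁+⋯+t_m = t_{m+1}+⋯+t_k}` whose distinct elements are uniformly
separated, and Haar-almost every unimodular lattice `gℤ^k`, the growth exponent
`γ_T(gℤ^k) = limsup_{t∈T,‖t‖→∞} (−log δ(g_t gℤ^k))/‖t‖` equals zero. -/
theorem ae_growth_exponent_zero (m n k : ℕ) (hm : 0 < m) (hn : 0 < n) (hk : k = m + n)
    (T : Set (Fin k → ℝ)) (hTc : T.Countable)
    (hTA : ∀ t ∈ T, (∀ i, 0 < t i) ∧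
      ∑ i ∈ Finset.univ.filter (fun i : Fin k => (i : ℕ) < m), t i =
        ∑ i ∈ Finset.univ.filter (fun i : Fin k => ¬ (i : ℕ) < m), t i)
    (hTunb : ∀ R : ℝ, ∃ t ∈ T, R ≤ ‖t‖)
    (hTsep : ∃ ε > (0 : ℝ), ∀ t₁ ∈ T, ∀ t₂ ∈ T, t₁ ≠ t₂ → ε ≤ dist t₁ t₂)
    (μ : Measure (Matrix.SpecialLinearGroup (Fin k) ℝ)) [μ.IsHaarMeasure] :
    ∀ᵐ g : Matrix.SpecialLinearGroup (Fin k) ℝ ∂μ,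
      Filter.limsup
        (fun t : Fin k → ℝ =>
          -Real.log (deltaLat (gMat m t * (↑g : Matrix (Fin k) (Fin k) ℝ))) / ‖t‖)
        ((Filter.atTop.comap fun t : Fin k → ℝ => ‖t‖) ⊓ Filter.principal T) = 0 := by
  have hk0 : k ≠ 0 := by omega
  have hall : ∀ᵐ g : Matrix.SpecialLinearGroup (Fin k) ℝ ∂μ, ∀ N M : ℕ,
      g ∈ compactCovering (Matrix.SpecialLinearGroup (Fin k) ℝ) N →
      {t : T | deltaLat (gMat m (t : Fin k → ℝ) * (g : Matrix (Fin k) (Fin k) ℝ)) <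
        Real.exp (-((1 / ((M : ℝ) + 1)) * ‖(t : Fin k → ℝ)‖))}.Finite := by
    rw [ae_all_iff]; intro N
    rw [ae_all_iff]; intro M
    exact ae_finite hk0 T hTc hTA hTsep μ _ (isCompact_compactCovering _ N) _ (by positivity)
  filter_upwards [hall] with g hg
  obtain ⟨N, hN⟩ := exists_mem_compactCovering g
  set l := (Filter.atTop.comap fun t : Fin k → ℝ => ‖t‖) ⊓ Filter.principal T with hl
  have : l.NeBot := by
    rw [hl, Filter.inf_principal_neBot_iff]
    intro U hU
    obtain ⟨V, hV, hVU⟩ := Filter.mem_comap.mp hU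
    obtain ⟨R, hR⟩ := Filter.mem_atTop_sets.mp hV
    obtain ⟨t, htT, ht⟩ := hTunb R
    exact ⟨t, hVU (hR _ ht), htT⟩
  have hT : ∀ᶠ t in l, t ∈ T := Filter.mem_inf_of_right (Filter.mem_principal_self T)
  have hbig : ∀ R : ℝ, ∀ᶠ t in l, R < ‖t‖ := fun R =>
    Filter.mem_inf_of_left ((Filter.eventually_gt_atTop R).comap _)
  refine Filter.Tendsto.limsup_eq ?_
  rw [Metric.tendsto_nhds]
  intro ε hε
  obtain ⟨M, hM⟩ := exists_nat_one_div_lt hε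
  have hfin := (hg N M hN).image (fun t : T => ‖(t : Fin k → ℝ)‖)
  obtain ⟨R, hR⟩ := hfin.bddAbove
  filter_upwards [hT, hbig R, hbig 0] with t ht htR ht0
  have hδ : Real.exp (-((1 / ((M : ℝ) + 1)) * ‖t‖)) ≤
      deltaLat (gMat m t * (g : Matrix (Fin k) (Fin k) ℝ)) := by
    by_contra! h
    exact absurd (hR ⟨⟨t, ht⟩, h, rfl⟩) (not_le.mpr htR)
  have hδ1 : deltaLat (gMat m t * (g : Matrix (Fin k) (Fin k) ℝ)) ≤ 1 := by
    apply delta_le_one hk0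
    rw [Matrix.det_mul, gMat_det t (hTA t ht).2, g.2, one_mul]
  set δ := deltaLat (gMat m t * (g : Matrix (Fin k) (Fin k) ℝ))
  have hδ0 : 0 < δ := (Real.exp_pos _).trans_le hδ
  have h1 : Real.log δ ≤ 0 := Real.log_nonpos hδ0.le hδ1
  have h2 : -((1 / ((M : ℝ) + 1)) * ‖t‖) ≤ Real.log δ := (Real.le_log_iff_exp_le hδ0).mpr hδ
  rw [Real.dist_eq, sub_zero, abs_of_nonneg (div_nonneg (by linarith) ht0.le)]
  refine lt_of_le_of_lt ?_ hM
  rw [div_le_iff₀ ht0]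
  linarith
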